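/- Fix x ∈ V, let μ_n = p^n(x, ·), and let (S_n) be the evolving set process started from S_0 = {x}. Then 2‖μ_n − π‖_TV ≤ χ(μ_n, π) ≤ (1/π(x)) E √(π(S_n^♯)), where for S ⊆ V, S^♯ = S if π(S) ≤ 1/2 and S^♯ = S^c otherwise. -/

import Mathlib

open MeasureTheory Set
open scoped ENNReal Classical

namespace EvolvingSetsPaper

variable {V : Type*}

/-- `π(S) = ∑_{y ∈ S} π(y)`. -/
noncomputable def piS (pi : V → ℝ) (S : Set V) : ℝ := ∑' y : S, pi y

/-- `Q(S, y) = ∑_{s ∈ S} π(s) p(s, y)`. -/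
noncomputable def QS (pi : V → ℝ) (p : V → V → ℝ) (S : Set V) (y : V) : ℝ :=
  ∑' s : S, pi s * p s y

/-- `Q(S, A) = ∑_{s ∈ S, a ∈ A} π(s) p(s, a)`. -/
noncomputable def Qset (pi : V → ℝ) (p : V → V → ℝ) (S A : Set V) : ℝ :=
  ∑' a : A, QS pi p S a

/-- The conductance `Φ_S = Q(S, Sᶜ)/π(S)`. -/
noncomputable def cond (pi : V → ℝ) (p : V → V → ℝ) (S : Set V) : ℝ :=
  Qset pi p S Sᶜ / piS pi S

/-- The conductance profile `Φ(r)`, constant for `r > 1/2`. -/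
noncomputable def profile (pi : V → ℝ) (p : V → V → ℝ) (r : ℝ) : ℝ :=
  if r ≤ 1 / 2 then sInf (cond pi p '' {S : Set V | 0 < piS pi S ∧ piS pi S ≤ r})
  else sInf (cond pi p '' {S : Set V | 0 < piS pi S ∧ piS pi S ≤ 1 / 2})

/-- `n`-step transition probabilities. -/
noncomputable def pn (p : V → V → ℝ) : ℕ → V → V → ℝ
  | 0 => fun x y => if x = y then 1 else 0
  | n + 1 => fun x y => ∑' z, pn p n x z * p z y

/-- One step of the evolving set process with uniform value `u`:
`S̃ = {y : Q(S,y) ≥ u π(y)}`. -/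
def esStep (pi : V → ℝ) (p : V → V → ℝ) (S : Set V) (u : ℝ) : Set V :=
  {y | u * pi y ≤ QS pi p S y}

/-- `esE pi p n F S = E_S[F(S_n)]` for the evolving set process started at `S`,
driven by i.i.d. uniform variables on `[0,1]`. -/
noncomputable def esE (pi : V → ℝ) (p : V → V → ℝ) : ℕ → (Set V → ℝ) → Set V → ℝ
  | 0 => fun F S => F S
  | n + 1 => fun F S => ∫ u in (0:ℝ)..1, esE pi p n F (esStep pi p S u)

/-- `ψ(S) = 1 - E_S √(π(S̃)/π(S))`. -/
noncomputable def psiSet (pi : V → ℝ) (p : V → V → ℝ) (S : Set V) : ℝ :=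
  1 - ∫ u in (0:ℝ)..1, Real.sqrt (piS pi (esStep pi p S u) / piS pi S)

/-- The root profile `ψ(r)`, constant for `r > 1/2`. -/
noncomputable def rootProfile (pi : V → ℝ) (p : V → V → ℝ) (r : ℝ) : ℝ :=
  if r ≤ 1 / 2 then sInf (psiSet pi p '' {S : Set V | 0 < piS pi S ∧ piS pi S ≤ r})
  else sInf (psiSet pi p '' {S : Set V | 0 < piS pi S ∧ piS pi S ≤ 1 / 2})

/-- `φ_S = (1/(2π(S))) ∑_y min(Q(S,y), Q(Sᶜ,y))`. -/
noncomputable def phiS (pi : V → ℝ) (p : V → V → ℝ) (S : Set V) : ℝ :=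
  (1 / (2 * piS pi S)) * ∑' y, min (QS pi p S y) (QS pi p Sᶜ y)

/-- `S^♯ = S` if `π(S) ≤ 1/2`, else `Sᶜ`. -/
noncomputable def sharp (pi : V → ℝ) (S : Set V) : Set V :=
  if piS pi S ≤ 1 / 2 then S else Sᶜ

/-- `χ²(μ, π) = ∑_y π(y) (μ(y)/π(y) - 1)²`. -/
noncomputable def chiSq (pi : V → ℝ) (mu : V → ℝ) : ℝ :=
  ∑' y, pi y * (mu y / pi y - 1) ^ 2



section helpers

theorem wsum {pi : V → ℝ} (hs : Summable pi) (h0 : ∀ y, 0 ≤ pi y) {f : V → ℝ} {C : ℝ}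
    (hf : ∀ y, |f y| ≤ C) : Summable (fun y => pi y * f y) := by
  refine Summable.of_norm_bounded (g := fun y => pi y * C) (hs.mul_right C) (fun y => ?_)
  rw [Real.norm_eq_abs, abs_mul, abs_of_nonneg (h0 y)]
  exact mul_le_mul_of_nonneg_left (hf y) (h0 y)

theorem wCS {pi : V → ℝ} (hs : Summable pi) (h0 : ∀ y, 0 ≤ pi y) {f g : V → ℝ} {C D : ℝ}
    (hf : ∀ y, |f y| ≤ C) (hg : ∀ y, |g y| ≤ D) :
    ∑' y, pi y * (f y * g y) ≤
      Real.sqrt (∑' y, pi y * f y ^ 2) * Real.sqrt (∑' y, pi y * g y ^ 2) := by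
  have sf : Summable (fun y => pi y * f y ^ 2) := wsum hs h0 (C := C ^ 2) (fun y => by
    rw [abs_pow]; exact pow_le_pow_left₀ (abs_nonneg _) (hf y) 2)
  have sg : Summable (fun y => pi y * g y ^ 2) := wsum hs h0 (C := D ^ 2) (fun y => by
    rw [abs_pow]; exact pow_le_pow_left₀ (abs_nonneg _) (hg y) 2)
  have sfg : Summable (fun y => pi y * (f y * g y)) := wsum hs h0 (C := C * D) (fun y => by
    rw [abs_mul]
    exact mul_le_mul (hf y) (hg y) (abs_nonneg _) ((abs_nonneg _).trans (hf y)))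
  refine sfg.tsum_le_of_sum_le ?_
  intro s
  calc ∑ y ∈ s, pi y * (f y * g y)
      = ∑ y ∈ s, (Real.sqrt (pi y) * f y) * (Real.sqrt (pi y) * g y) := by
        refine Finset.sum_congr rfl fun y _ => ?_
        linear_combination (-(f y * g y)) * Real.mul_self_sqrt (h0 y)
    _ ≤ _ := Real.sum_mul_le_sqrt_mul_sqrt s _ _
    _ ≤ _ := by
        have e : ∀ h : V → ℝ, ∀ y, (Real.sqrt (pi y) * h y) ^ 2 = pi y * h y ^ 2 := fun h y => by
          rw [mul_pow, Real.sq_sqrt (h0 y)]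
        simp only [e]
        refine mul_le_mul (Real.sqrt_le_sqrt ?_) (Real.sqrt_le_sqrt ?_) (Real.sqrt_nonneg _)
          (Real.sqrt_nonneg _)
        · exact sf.sum_le_tsum s (fun y _ => mul_nonneg (h0 y) (sq_nonneg _))
        · exact sg.sum_le_tsum s (fun y _ => mul_nonneg (h0 y) (sq_nonneg _))

theorem tsum_swap [Countable V] {Ω : Type*} [MeasurableSpace Ω] {μ : Measure Ω}
    [IsProbabilityMeasure μ] {F : V → Ω → ℝ} (hF : ∀ y, Measurable (F y)) {w : V → ℝ}
    (hw : Summable w) (hb : ∀ y ω, |F y ω| ≤ w y) :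
    ∑' y, ∫ ω, F y ω ∂μ = ∫ ω, ∑' y, F y ω ∂μ := by
  have hint : ∀ y, Integrable (F y) μ := fun y =>
    Integrable.of_bound (hF y).aestronglyMeasurable (w y) (ae_of_all _ (hb y))
  refine integral_tsum_of_summable_integral_norm hint ?_
  refine Summable.of_nonneg_of_le (fun y => integral_nonneg fun ω => norm_nonneg _)
    (fun y => ?_) hw
  calc ∫ ω, ‖F y ω‖ ∂μ ≤ ∫ ω, w y ∂μ :=
        integral_mono (hint y).norm (integrable_const _) (hb y)
    _ = w y := by simp

/-- indicator of membership, as a function of the set -/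
noncomputable def ind (y : V) (S : Set V) : ℝ := if y ∈ S then 1 else 0

theorem ind_meas (y : V) : Measurable (ind y) :=
  Measurable.ite (measurableSet_setOf.2 (measurable_set_mem y)) measurable_const measurable_const

theorem ind_nonneg (y : V) (S : Set V) : 0 ≤ ind y S := by unfold ind; split_ifs <;> norm_num
theorem ind_le (y : V) (S : Set V) : ind y S ≤ 1 := by unfold ind; split_ifs <;> norm_num
theorem ind_abs (y : V) (S : Set V) : |ind y S| ≤ 1 := by unfold ind; split_ifs <;> norm_num

theorem piS_eq (pi : V → ℝ) (S : Set V) : piS pi S = ∑' y, pi y * ind y S := by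
  unfold piS
  rw [tsum_subtype S pi]
  refine tsum_congr fun y => ?_
  by_cases h : y ∈ S <;> simp [ind, h]

theorem QS_eq (pi : V → ℝ) (p : V → V → ℝ) (S : Set V) (y : V) :
    QS pi p S y = ∑' z, (pi z * p z y) * ind z S := by
  unfold QS
  rw [tsum_subtype S (fun z => pi z * p z y)]
  refine tsum_congr fun z => ?_
  by_cases h : z ∈ S <;> simp [ind, h]

theorem wmeas [Countable V] (w : V → ℝ) :
    Measurable (fun S : Set V => ∑' y, w y * ind y S) := by
  refine Measurable.tsum (fun y => ?_)
  exact (ind_meas y).const_mul _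

theorem step_meas [Countable V] (pi : V → ℝ) (p : V → V → ℝ) :
    Measurable (fun q : Set V × ℝ => esStep pi p q.1 q.2) := by
  rw [measurable_set_iff]
  intro y
  refine measurableSet_setOf.1 ?_
  have : Measurable (fun q : Set V × ℝ => QS pi p q.1 y) := by
    simp only [QS_eq]
    exact (wmeas _).comp measurable_fst
  exact measurableSet_le (measurable_snd.mul_const _) this

/-- the law of `S_n` -/
noncomputable def law (pi : V → ℝ) (p : V → V → ℝ) (x : V) : ℕ → Measure (Set V)
  | 0 => Measure.dirac {x}
  | n + 1 => ((law pi p x n).prod ((volume : Measure ℝ).restrict (Ioc 0 1))).map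
      (fun q => esStep pi p q.1 q.2)

instance : IsProbabilityMeasure ((volume : Measure ℝ).restrict (Ioc 0 1)) := ⟨by simp⟩

theorem law_prob [Countable V] (pi : V → ℝ) (p : V → V → ℝ) (x : V) (n : ℕ) :
    IsProbabilityMeasure (law pi p x n) := by
  induction n with
  | zero => unfold law; infer_instance
  | succ n ih =>
    unfold law
    exact Measure.isProbabilityMeasure_map (step_meas pi p).aemeasurable

theorem esE_succ' (pi : V → ℝ) (p : V → V → ℝ) (n : ℕ) (F : Set V → ℝ) (S : Set V) :
    esE pi p (n + 1) F S =
      esE pi p n (fun T => ∫ u in (0:ℝ)..1, F (esStep pi p T u)) S := by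
  induction n generalizing S with
  | zero => rfl
  | succ n ih =>
    rw [esE]
    simp only [ih]
    rfl

theorem law_succ [Countable V] (pi : V → ℝ) (p : V → V → ℝ) (x : V) (n : ℕ) {F : Set V → ℝ}
    (hF : Measurable F) {C : ℝ} (hC : ∀ S, |F S| ≤ C) :
    ∫ S, F S ∂(law pi p x (n + 1)) =
      ∫ S, (∫ u in (0:ℝ)..1, F (esStep pi p S u)) ∂(law pi p x n) := by
  haveI := law_prob pi p x n
  rw [law, integral_map (step_meas pi p).aemeasurable hF.aestronglyMeasurable, integral_prod]
  · simp only [intervalIntegral.integral_of_le (zero_le_one' ℝ)]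
  · exact Integrable.of_bound (hF.comp (step_meas pi p)).aestronglyMeasurable C
      (ae_of_all _ fun q => hC _)

theorem esE_law [Countable V] (pi : V → ℝ) (p : V → V → ℝ) (x : V) (n : ℕ) {F : Set V → ℝ}
    (hF : Measurable F) {C : ℝ} (hC : ∀ S, |F S| ≤ C) :
    esE pi p n F {x} = ∫ S, F S ∂(law pi p x n) := by
  induction n generalizing F C with
  | zero => rw [law, integral_dirac' _ _ hF.stronglyMeasurable]; rfl
  | succ n ih =>
    rw [esE_succ', law_succ pi p x n hF hC]
    refine ih (C := C) ?_ ?_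
    · simp only [intervalIntegral.integral_of_le (zero_le_one' ℝ)]
      exact (StronglyMeasurable.integral_prod_right
        (f := fun S u => F (esStep pi p S u))
        (hF.comp (step_meas pi p)).stronglyMeasurable).measurable
    · intro S
      have := intervalIntegral.norm_integral_le_of_norm_le_const (a := 0) (b := 1) (C := C)
        (f := fun u => F (esStep pi p S u)) (fun u _ => hC _)
      simpa using this

theorem int_step {a c : ℝ} (hc : 0 < c) (h0 : 0 ≤ a) (h1 : a ≤ c) :
    c * ∫ u in (0:ℝ)..1, (if u * c ≤ a then (1:ℝ) else 0) = a := by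
  have e : (fun u : ℝ => if u * c ≤ a then (1:ℝ) else 0) =
      (Iic (a / c)).indicator (fun _ => (1:ℝ)) := by
    funext u
    simp [Set.indicator, le_div_iff₀ hc]
  rw [intervalIntegral.integral_of_le zero_le_one, e, integral_indicator measurableSet_Iic,
    Measure.restrict_restrict measurableSet_Iic, inter_comm, Ioc_inter_Iic,
    min_eq_right ((div_le_one hc).2 h1)]
  simp [Measure.real, div_nonneg h0 hc.le]
  field_simp

theorem dual [Countable V] {p : V → V → ℝ} {pi : V → ℝ}
    (hp0 : ∀ x y, 0 ≤ p x y)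
    (hpipos : ∀ x, 0 < pi x)
    (hstat : ∀ y, ∑' x, pi x * p x y = pi y) (x : V) (n : ℕ) (y : V) :
    pi y * ∫ S, ind y S ∂(law pi p x n) = pi x * pn p n x y := by
  induction n generalizing y with
  | zero =>
    rw [law, integral_dirac' _ _ (ind_meas y).stronglyMeasurable]
    by_cases h : x = y
    · subst h; simp [ind, pn]
    · have : ¬ y = x := fun h' => h h'.symm
      simp [ind, pn, h, this]
  | succ n ih =>
    haveI := law_prob pi p x n
    have hsum : Summable (fun z => pi z * p z y) := by
      by_contra h
      have := tsum_eq_zero_of_not_summable h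
      rw [hstat] at this
      exact (hpipos y).ne' this
    have h0 : ∀ z, 0 ≤ pi z * p z y := fun z => mul_nonneg (hpipos z).le (hp0 z y)
    have hQ0 : ∀ S, 0 ≤ QS pi p S y := fun S => by
      rw [QS_eq]; exact tsum_nonneg fun z => mul_nonneg (h0 z) (ind_nonneg z S)
    have hQ1 : ∀ S, QS pi p S y ≤ pi y := fun S => by
      rw [QS_eq, ← hstat y]
      exact (wsum hsum h0 (fun z => ind_abs z S)).tsum_le_tsum
        (fun z => mul_le_of_le_one_right (h0 z) (ind_le z S)) hsum
    rw [law_succ pi p x n (ind_meas y) (ind_abs y), ← integral_const_mul]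
    have : ∀ S, pi y * (∫ u in (0:ℝ)..1, ind y (esStep pi p S u)) =
        ∑' z, (pi z * p z y) * ind z S := fun S => by
      rw [← QS_eq]
      exact int_step (hpipos y) (hQ0 S) (hQ1 S)
    simp only [this]
    rw [← tsum_swap (w := fun z => pi z * p z y) (fun z => (ind_meas z).const_mul _) hsum]
    · rw [pn, ← tsum_mul_left]
      refine tsum_congr fun z => ?_
      rw [integral_const_mul]
      linear_combination p z y * ih z
    · intro z S
      rw [abs_mul, abs_of_nonneg (h0 z)]
      exact mul_le_of_le_one_right (h0 z) (ind_abs z S)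

theorem pn_sum {p : V → V → ℝ}
    (hp0 : ∀ x y, 0 ≤ p x y) (hp1 : ∀ x, ∑' y, p x y = 1) (x : V) (n : ℕ) :
    (∀ y, 0 ≤ pn p n x y) ∧ HasSum (pn p n x) 1 := by
  induction n with
  | zero =>
    refine ⟨fun y => by simp only [pn]; split_ifs <;> norm_num, ?_⟩
    have := hasSum_ite_eq x (1:ℝ)
    simpa only [pn, eq_comm] using this
  | succ n ih =>
    obtain ⟨h0, h1⟩ := ih
    refine ⟨fun y => by simp only [pn]; exact tsum_nonneg fun z => mul_nonneg (h0 z) (hp0 z y), ?_⟩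
    have hps : ∀ z, Summable (p z) := fun z => by
      by_contra h
      have := tsum_eq_zero_of_not_summable h
      rw [hp1] at this
      exact one_ne_zero this
    have hS0 : Summable (fun q : V × V => pn p n x q.1 * p q.1 q.2) := by
      refine (summable_prod_of_nonneg (fun q => ?_)).2 ⟨fun z => (hps z).mul_left (pn p n x z), ?_⟩
      · exact mul_nonneg (h0 q.1) (hp0 q.1 q.2)
      simp only [tsum_mul_left, hp1, mul_one]
      exact h1.summable
    have hS : Summable (Function.uncurry fun z y => pn p n x z * p z y) := hS0
    have hS2 : Summable (fun y => ∑' z, pn p n x z * p z y) := hS0.prod_symm.prod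
    have e : ∑' y, ∑' z, pn p n x z * p z y = 1 := by
      rw [hS.tsum_comm]
      simp only [tsum_mul_left, hp1, mul_one]
      exact h1.tsum_eq
    have h3 := hS2.hasSum
    rw [e] at h3
    exact h3

end helpers

/-- Inequality (chibound): `2‖μ_n - π‖_TV ≤ χ(μ_n, π) ≤ (1/π(x)) E √(π(S_n^♯))`
for the evolving set process started from `{x}`. -/
theorem tv_le_chi_le_evolving_sets [Countable V]
    (p : V → V → ℝ) (pi : V → ℝ)
    (hp0 : ∀ x y, 0 ≤ p x y) (hp1 : ∀ x, ∑' y, p x y = 1)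
    (hpipos : ∀ x, 0 < pi x) (hpi1 : ∑' x, pi x = 1)
    (hstat : ∀ y, ∑' x, pi x * p x y = pi y)
    (hirr : ∀ x y : V, ∃ n, 0 < pn p n x y)
    (x : V) (n : ℕ) :
    2 * ((1 : ℝ) / 2 * ∑' y, |pn p n x y - pi y|) ≤
        Real.sqrt (chiSq pi (pn p n x)) ∧
      Real.sqrt (chiSq pi (pn p n x)) ≤
        1 / pi x * esE pi p n (fun T => Real.sqrt (piS pi (sharp pi T))) {x} := by
  have hs : Summable pi := by
    by_contra h
    have := tsum_eq_zero_of_not_summable h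
    rw [hpi1] at this
    exact one_ne_zero this
  have h0 : ∀ y, 0 ≤ pi y := fun y => (hpipos y).le
  haveI := law_prob pi p x n
  set μ := law pi p x n with hμ
  have hdual := dual hp0 hpipos hstat x n
  obtain ⟨-, hpn1⟩ := pn_sum hp0 hp1 x n
  have hx := hpipos x
  have hindint : ∀ y, Integrable (ind y) μ := fun y =>
    Integrable.of_bound (ind_meas y).aestronglyMeasurable 1 (ae_of_all _ (ind_abs y))
  have hpS0 : ∀ S, 0 ≤ piS pi S := fun S => by
    rw [piS_eq]; exact tsum_nonneg fun y => mul_nonneg (h0 y) (ind_nonneg y S)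
  have hsi : ∀ S, Summable (fun y => pi y * ind y S) := fun S => wsum hs h0 (fun y => ind_abs y S)
  have hpS1 : ∀ S, piS pi S ≤ 1 := fun S => by
    rw [piS_eq, ← hpi1]
    exact (hsi S).tsum_le_tsum (fun y => mul_le_of_le_one_right (h0 y) (ind_le y S)) hs
  have hpSm : Measurable (piS pi) := by
    have := wmeas pi
    simpa only [← piS_eq] using this
  have hpSint : Integrable (piS pi) μ :=
    Integrable.of_bound hpSm.aestronglyMeasurable 1 (ae_of_all _ fun S => by
      rw [Real.norm_eq_abs, abs_of_nonneg (hpS0 S)]; exact hpS1 S)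
  -- mean of the measure of the set
  have hmean : ∫ S, piS pi S ∂μ = pi x := by
    simp only [piS_eq]
    rw [← tsum_swap (w := pi) (fun z => (ind_meas z).const_mul _) hs]
    · simp only [integral_const_mul, hμ, hdual]
      rw [tsum_mul_left, hpn1.tsum_eq, mul_one]
    · intro z S
      rw [abs_mul, abs_of_nonneg (h0 z)]
      exact mul_le_of_le_one_right (h0 z) (ind_abs z S)
  have hcompl : ∀ S, piS pi Sᶜ = 1 - piS pi S := fun S => by
    rw [piS_eq, piS_eq, ← hpi1, ← hs.tsum_sub (hsi S)]
    refine tsum_congr fun y => ?_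
    by_cases h : y ∈ S <;> simp [ind, h]
  have hsharp : ∀ S, piS pi (sharp pi S) =
      if piS pi S ≤ 1 / 2 then piS pi S else 1 - piS pi S := fun S => by
    unfold sharp
    split_ifs
    · rfl
    · exact hcompl S
  have hFm : Measurable (fun T => Real.sqrt (piS pi (sharp pi T))) := by
    refine Measurable.sqrt ?_
    simp only [hsharp]
    exact Measurable.ite (measurableSet_le hpSm measurable_const) hpSm (hpSm.const_sub _)
  have hFb : ∀ T, |Real.sqrt (piS pi (sharp pi T))| ≤ 1 := fun T => by
    rw [abs_of_nonneg (Real.sqrt_nonneg _), Real.sqrt_le_left (by norm_num), one_pow]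
    exact hpS1 _
  rw [esE_law pi p x n hFm hFb]
  -- the function `f S y = 1_S(y) - π(S)`
  set f : V → Set V → ℝ := fun y S => ind y S - piS pi S with hf
  have hfm : ∀ y, Measurable (f y) := fun y => (ind_meas y).sub hpSm
  have hfb : ∀ y S, |f y S| ≤ 1 := fun y S => by
    rw [abs_le]
    have := ind_le y S
    have := ind_nonneg y S
    have := hpS0 S
    have := hpS1 S
    constructor <;> simp only [hf] <;> linarith
  set g : V → ℝ := fun y => ∫ S, f y S ∂μ with hg
  have hgb : ∀ y, |g y| ≤ 1 := fun y => by
    have := norm_integral_le_of_norm_le_const (μ := μ) (f := f y) (C := 1) (ae_of_all _ (hfb y))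
    simpa using this
  have hgeq : ∀ y, pn p n x y / pi y - 1 = 1 / pi x * g y := fun y => by
    have e : g y = (∫ S, ind y S ∂μ) - pi x := by
      simp only [hg, hf]
      rw [integral_sub (hindint y) hpSint, hmean]
    have hy := (hpipos y).ne'
    have hd := hdual y
    rw [← hμ] at hd
    rw [e]
    field_simp
    linear_combination -hd
  set A := ∑' y, pi y * g y ^ 2 with hA
  have hA0 : 0 ≤ A := tsum_nonneg fun y => mul_nonneg (h0 y) (sq_nonneg _)
  have hchi : chiSq pi (pn p n x) = (1 / pi x) ^ 2 * A := by
    unfold chiSq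
    rw [hA, ← tsum_mul_left]
    refine tsum_congr fun y => ?_
    rw [hgeq]; ring
  have hsq : Real.sqrt (chiSq pi (pn p n x)) = 1 / pi x * Real.sqrt A := by
    rw [hchi, Real.sqrt_mul (sq_nonneg _), Real.sqrt_sq (by positivity)]
  constructor
  · have e : ∀ y, |pn p n x y - pi y| = 1 / pi x * (pi y * (|g y| * 1)) := fun y => by
      have hy := hpipos y
      have : pn p n x y - pi y = pi y * (1 / pi x * g y) := by
        rw [← hgeq]; field_simp
      rw [this, abs_mul, abs_mul, abs_of_pos hy, abs_of_pos (by positivity : 0 < 1 / pi x)]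
      ring
    simp only [e]
    rw [hsq, tsum_mul_left]
    have := wCS hs h0 (f := fun y => |g y|) (g := fun _ => 1) (C := 1) (D := 1)
      (fun y => by rw [abs_abs]; exact hgb y) (fun y => by simp)
    simp only [sq_abs, one_pow, mul_one, hpi1, Real.sqrt_one] at this
    have h2 := mul_le_mul_of_nonneg_left this (by positivity : 0 ≤ 1 / pi x)
    simp only [mul_one]
    linarith
  · rw [hsq]
    refine mul_le_mul_of_nonneg_left ?_ (by positivity)
    set E := ∫ S, Real.sqrt (piS pi (sharp pi S)) ∂μ with hE
    have hE0 : 0 ≤ E := integral_nonneg fun S => Real.sqrt_nonneg _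
    have hnorm : ∀ S, ∑' y, pi y * f y S ^ 2 = piS pi S * (1 - piS pi S) := fun S => by
      have e : ∀ y, pi y * f y S ^ 2 =
          (1 - 2 * piS pi S) * (pi y * ind y S) + piS pi S ^ 2 * pi y := fun y => by
        by_cases h : y ∈ S <;> simp [hf, ind, h] <;> ring
      simp only [e]
      rw [((hsi S).mul_left _).tsum_add (hs.mul_left _), tsum_mul_left, tsum_mul_left, hpi1,
        ← piS_eq]
      ring
    have hle : ∀ S, Real.sqrt (∑' y, pi y * f y S ^ 2) ≤ Real.sqrt (piS pi (sharp pi S)) :=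
      fun S => by
        refine Real.sqrt_le_sqrt ?_
        rw [hnorm, hsharp]
        have := hpS0 S
        have := hpS1 S
        split_ifs <;> nlinarith
    have hAE : A ≤ Real.sqrt A * E := by
      have e : A = ∫ S, ∑' y, pi y * (g y * f y S) ∂μ := by
        rw [← tsum_swap (w := pi) (fun y => ((hfm y).const_mul _).const_mul _) hs]
        · rw [hA]
          refine tsum_congr fun y => ?_
          rw [integral_const_mul, integral_const_mul]
          simp only [hg]; ring
        · intro y S
          rw [abs_mul, abs_mul, abs_of_nonneg (h0 y)]
          exact mul_le_of_le_one_right (h0 y)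
            (mul_le_one₀ (hgb y) (abs_nonneg _) (hfb y S))
      have hmono : ∀ S, ∑' y, pi y * (g y * f y S) ≤
          Real.sqrt A * Real.sqrt (piS pi (sharp pi S)) := fun S =>
        (wCS hs h0 hgb (fun y => hfb y S)).trans
          (mul_le_mul_of_nonneg_left (hle S) (Real.sqrt_nonneg _))
      have hRi : Integrable (fun S => Real.sqrt A * Real.sqrt (piS pi (sharp pi S))) μ :=
        (Integrable.of_bound hFm.aestronglyMeasurable 1 (ae_of_all _ hFb)).const_mul _
      have hLm : Measurable (fun S => ∑' y, pi y * (g y * f y S)) :=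
        Measurable.tsum fun y => ((hfm y).const_mul _).const_mul _
      have hLi : Integrable (fun S => ∑' y, pi y * (g y * f y S)) μ := by
        refine Integrable.of_bound hLm.aestronglyMeasurable 1 (ae_of_all _ fun S => ?_)
        rw [← hpi1]
        refine tsum_of_norm_bounded hs.hasSum fun y => ?_
        rw [Real.norm_eq_abs, abs_mul, abs_mul, abs_of_nonneg (h0 y)]
        exact mul_le_of_le_one_right (h0 y)
            (mul_le_one₀ (hgb y) (abs_nonneg _) (hfb y S))
      calc A = _ := e
        _ ≤ ∫ S, Real.sqrt A * Real.sqrt (piS pi (sharp pi S)) ∂μ := integral_mono hLi hRi hmono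
        _ = _ := by rw [integral_const_mul]
    rcases (Real.sqrt_nonneg A).eq_or_lt with h | h
    · rw [← h]; exact hE0
    · have := Real.mul_self_sqrt hA0
      refine le_of_mul_le_mul_left ?_ h
      linarith

end EvolvingSetsPaper
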